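/- arXiv:1311.2571 — 2 statements merged into one kernel-verified Lean document; each statement's English description precedes it below -/
import Mathlib

section
/- Let d ≥ 2 and suppose that C(d−1) has a k_{d−1}-uniform-covering. Then C(d) has a k_d-uniform-covering with k_d = k_{d−1} + 2·3^{d−1}. -/
/-- Bit strings of length `n`. -/
abbrev BitStr (n : ℕ) : Type := Fin n → Bool

/-- The inner product `aᵀb = Σᵢ aᵢbᵢ` of two bit strings (a natural number;
its value over `ℝ` is obtained by coercion). -/
def bitIP {n : ℕ} (a b : BitStr n) : ℕ := ∑ i, if a i && b i then 1 else 0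

/-- A rectangle: a set of pairs of the form `I × J`. -/
def IsRectangle {d : ℕ} (R : Finset (BitStr d × BitStr d)) : Prop :=
  ∃ I J : Finset (BitStr d), R = I ×ˢ J

/-- The rectangles `R 0, …, R (k-1)` witness a `k`-uniform-covering of the set `S`:
each `R i` is a rectangle supported on the disjoint pairs, and for every `M ∈ S`
there is an injective map `φ` sending each disjoint pair on which `M` is positive
to (the index of) a rectangle containing that pair. -/
def UniformCoveringWith {d : ℕ} (S : Set (Matrix (BitStr d) (BitStr d) ℝ)) {k : ℕ}
    (R : Fin k → Finset (BitStr d × BitStr d)) : Prop :=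
  (∀ i, IsRectangle (R i)) ∧
  (∀ i, ∀ p ∈ R i, bitIP p.1 p.2 = 0) ∧
  ∀ M ∈ S, ∃ φ : {p : BitStr d × BitStr d // bitIP p.1 p.2 = 0 ∧ 0 < M p.1 p.2} → Fin k,
    Function.Injective φ ∧ ∀ p, (p : BitStr d × BitStr d) ∈ R (φ p)

/-- The set `S` of `2^d × 2^d` nonnegative matrices has a `k`-uniform-covering. -/
def HasUniformCovering {d : ℕ} (S : Set (Matrix (BitStr d) (BitStr d) ℝ)) (k : ℕ) : Prop :=
  ∃ R : Fin k → Finset (BitStr d × BitStr d), UniformCoveringWith S R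

/-- The set `C(d)` of nonnegative `2^d × 2^d` matrices vanishing on all pairs with
`aᵀb = 1` and having at least one zero entry on the antidiagonal. -/
def Cset (d : ℕ) : Set (Matrix (BitStr d) (BitStr d) ℝ) :=
  {M | (∀ a b, 0 ≤ M a b) ∧ (∀ a b, bitIP a b = 1 → M a b = 0) ∧
    ∃ α : BitStr d, M α (fun i => !(α i)) = 0}

theorem bitIP_eq_zero_iff {n : ℕ} (a b : BitStr n) :
    bitIP a b = 0 ↔ ∀ i, (a i && b i) = false := by
  simp [bitIP]

theorem bitIP_succ_eq_zero_iff {n : ℕ} (a b : BitStr (n + 1)) :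
    bitIP a b = 0 ↔ (a 0 && b 0) = false ∧ bitIP (Fin.tail a) (Fin.tail b) = 0 := by
  simp only [bitIP_eq_zero_iff, Fin.forall_fin_succ, Fin.tail]

theorem BitStr.eq_of_tail_eq {n : ℕ} {a b : BitStr (n + 1)} (h0 : a 0 = b 0)
    (h : Fin.tail a = Fin.tail b) : a = b :=
  funext (Fin.cases h0 (congrFun h))

/-- The pairs of disjoint bit strings of length `n`. -/
abbrev DisjPair (n : ℕ) : Type := {p : BitStr n × BitStr n // bitIP p.1 p.2 = 0}

/-- A pair of disjoint bit strings is a string of disjoint pairs of bits. -/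
def disjPairEquiv (n : ℕ) :
    DisjPair n ≃ (Fin n → {q : Bool × Bool // (q.1 && q.2) = false}) where
  toFun p i := ⟨(p.1.1 i, p.1.2 i), (bitIP_eq_zero_iff _ _).1 p.2 i⟩
  invFun f := ⟨(fun i => (f i).1.1, fun i => (f i).1.2),
    (bitIP_eq_zero_iff _ _).2 fun i => (f i).2⟩
  left_inv _ := rfl
  right_inv _ := rfl

theorem card_disjPair (n : ℕ) : Fintype.card (DisjPair n) = 3 ^ n := by
  have h : Fintype.card {q : Bool × Bool // (q.1 && q.2) = false} = 3 := by decide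
  rw [Fintype.card_congr (disjPairEquiv n), Fintype.card_fun, h, Fintype.card_fin]

/-- A uniform covering may be indexed by any finite type of the right cardinality. -/
theorem hasUniformCovering_of_fintype {d k : ℕ} {S : Set (Matrix (BitStr d) (BitStr d) ℝ)}
    {ι : Type} [Fintype ι] (hι : Fintype.card ι = k) (R : ι → Finset (BitStr d × BitStr d))
    (hrect : ∀ i, IsRectangle (R i)) (hdisj : ∀ i, ∀ p ∈ R i, bitIP p.1 p.2 = 0)
    (hS : ∀ M ∈ S, ∃ φ : {p : BitStr d × BitStr d // bitIP p.1 p.2 = 0 ∧ 0 < M p.1 p.2} → ι,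
      Function.Injective φ ∧ ∀ p, (p : BitStr d × BitStr d) ∈ R (φ p)) :
    HasUniformCovering S k := by
  let e : ι ≃ Fin k := Fintype.equivFinOfCardEq hι
  refine ⟨fun i => R (e.symm i), fun i => hrect _, fun i => hdisj _, fun M hM => ?_⟩
  obtain ⟨φ, hφ, hmem⟩ := hS M hM
  exact ⟨fun p => e (φ p), e.injective.comp hφ, fun p => by simpa using hmem p⟩

/-- In a uniform covering of `Cset d`, all disjoint pairs but a given antidiagonal one can be
assigned distinct rectangles. -/
theorem UniformCoveringWith.exists_injective_of_ne {d k : ℕ}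
    {R : Fin k → Finset (BitStr d × BitStr d)} (h : UniformCoveringWith (Cset d) R)
    (α : BitStr d) :
    ∃ φ : {p : DisjPair d // p.1 ≠ (α, fun i => !(α i))} → Fin k,
      Function.Injective φ ∧ ∀ p, p.1.1 ∈ R (φ p) := by
  let M : Matrix (BitStr d) (BitStr d) ℝ := fun a b =>
    if bitIP a b = 0 ∧ (a, b) ≠ (α, fun i => !(α i)) then 1 else 0
  have hM : M ∈ Cset d := by
    refine ⟨fun a b => ?_, fun a b hab => ?_, α, ?_⟩
    · dsimp only [M]; split_ifs <;> norm_num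
    · simp [M, hab]
    · simp [M]
  obtain ⟨φ, hφ, hmem⟩ := h.2.2 M hM
  have hpos (p : {p : DisjPair d // p.1 ≠ (α, fun i => !(α i))}) :
      0 < M p.1.1.1 p.1.1.2 := by
    dsimp only [M]
    rw [if_pos ⟨p.1.2, p.2⟩]
    exact one_pos
  refine ⟨fun p => φ ⟨p.1.1, p.1.2, hpos p⟩, fun p q hpq => ?_, fun p => hmem _⟩
  exact Subtype.ext (Subtype.ext (Subtype.mk.inj (hφ hpq)))

/-- The rectangles covering the disjoint pairs of length `n + 1`: those of a covering in length
`n`, extended by zero bits, and for each disjoint pair of length `n` its two extensions in which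
the first bit of one side (the left one for `true`) is left free and the other is zero. -/
def extendRect {n k : ℕ} (R : Fin k → Finset (BitStr n × BitStr n)) :
    Fin k ⊕ DisjPair n × Bool → Finset (BitStr (n + 1) × BitStr (n + 1))
  | .inl i => {p | p.1 0 = false ∧ p.2 0 = false ∧ (Fin.tail p.1, Fin.tail p.2) ∈ R i}
  | .inr (q, c) => {p | (c = false → p.1 0 = false) ∧ (c = true → p.2 0 = false) ∧
      (Fin.tail p.1, Fin.tail p.2) = q.1}

theorem isRectangle_extendRect {n k : ℕ} {R : Fin k → Finset (BitStr n × BitStr n)}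
    (hR : ∀ i, IsRectangle (R i)) (j : Fin k ⊕ DisjPair n × Bool) :
    IsRectangle (extendRect R j) := by
  obtain i | ⟨q, c⟩ := j
  · obtain ⟨I, J, hIJ⟩ := hR i
    refine ⟨Finset.univ.filter fun a => a 0 = false ∧ Fin.tail a ∈ I,
      Finset.univ.filter fun b => b 0 = false ∧ Fin.tail b ∈ J, ?_⟩
    ext p
    simp only [extendRect, hIJ, Finset.mem_filter_univ, Finset.mem_product]
    tauto
  · refine ⟨Finset.univ.filter fun a => (c = false → a 0 = false) ∧ Fin.tail a = q.1.1,
      Finset.univ.filter fun b => (c = true → b 0 = false) ∧ Fin.tail b = q.1.2, ?_⟩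
    ext p
    simp only [extendRect, Finset.mem_filter_univ, Finset.mem_product, Prod.ext_iff]
    tauto

theorem bitIP_eq_zero_of_mem_extendRect {n k : ℕ} {R : Fin k → Finset (BitStr n × BitStr n)}
    (hR : ∀ i, ∀ p ∈ R i, bitIP p.1 p.2 = 0) (j : Fin k ⊕ DisjPair n × Bool)
    (p : BitStr (n + 1) × BitStr (n + 1)) (hp : p ∈ extendRect R j) :
    bitIP p.1 p.2 = 0 := by
  rw [bitIP_succ_eq_zero_iff]
  obtain i | ⟨q, c⟩ := j
  · simp only [extendRect, Finset.mem_filter_univ] at hp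
    exact ⟨by simp [hp.1], hR i _ hp.2.2⟩
  · simp only [extendRect, Finset.mem_filter_univ] at hp
    refine ⟨by cases c <;> simp_all, ?_⟩
    have hq := q.2
    rwa [← hp.2.2] at hq

theorem bits_eq_of_key_eq {T : Prop} {s a b a' b' : Bool}
    (hab : (a && b) = false) (hab' : (a' && b') = false)
    (hne : a = s → b = !s → ¬T) (hne' : a' = s → b' = !s → ¬T) (hT : ¬(a = b ∧ ¬T))
    (hT' : ¬(a' = b' ∧ ¬T)) (h : (if a = b then s else a) = if a' = b' then s else a') :
    a = a' ∧ b = b' := by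
  by_cases hT : T <;> cases s <;> cases a <;> cases b <;> cases a' <;> cases b' <;> simp_all

theorem hasUniformCovering_succ {n k : ℕ} (h : HasUniformCovering (Cset n) k) :
    HasUniformCovering (Cset (n + 1)) (k + 2 * 3 ^ n) := by
  obtain ⟨R, hR⟩ := h
  refine hasUniformCovering_of_fintype
    (by simp [card_disjPair, mul_comm]) (extendRect R)
    (isRectangle_extendRect hR.1) (bitIP_eq_zero_of_mem_extendRect hR.2.1) ?_
  rintro M ⟨-, -, α, hα⟩
  obtain ⟨ψ, hψ, hmem⟩ := hR.exists_injective_of_ne (Fin.tail α)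
  let P := {p : BitStr (n + 1) × BitStr (n + 1) // bitIP p.1 p.2 = 0 ∧ 0 < M p.1 p.2}
  obtain ⟨t, ht⟩ : ∃ t : P → DisjPair n, ∀ p, (t p).1 = (Fin.tail p.1.1, Fin.tail p.1.2) :=
    ⟨fun p => ⟨_, ((bitIP_succ_eq_zero_iff _ _).1 p.2.1).2⟩, fun _ => rfl⟩
  have hbit (p : P) : (p.1.1 0 && p.1.2 0) = false := ((bitIP_succ_eq_zero_iff _ _).1 p.2.1).1
  have hext (p q : P) (h1 : p.1.1 0 = q.1.1 0) (h2 : p.1.2 0 = q.1.2 0) (h3 : t p = t q) :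
      p = q := by
    have h4 := congrArg Subtype.val h3
    rw [ht, ht, Prod.mk.injEq] at h4
    exact Subtype.ext (Prod.ext (BitStr.eq_of_tail_eq h1 h4.1) (BitStr.eq_of_tail_eq h2 h4.2))
  have hne (p : P) (h1 : p.1.1 0 = α 0) (h2 : p.1.2 0 = !(α 0)) :
      (t p).1 ≠ (Fin.tail α, fun i => !(Fin.tail α i)) := by
    intro h3
    rw [ht, Prod.mk.injEq] at h3
    have ha : p.1.1 = α := BitStr.eq_of_tail_eq h1 h3.1
    have hb : p.1.2 = fun i => !(α i) := BitStr.eq_of_tail_eq h2 h3.2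
    have hpos := p.2.2
    rw [ha, hb, hα] at hpos
    exact lt_irrefl _ hpos
  refine ⟨fun p => if hp : p.1.1 0 = p.1.2 0 ∧
      (t p).1 ≠ (Fin.tail α, fun i => !(Fin.tail α i)) then .inl (ψ ⟨t p, hp.2⟩)
    else .inr (t p, if p.1.1 0 = p.1.2 0 then α 0 else p.1.1 0), fun p q hpq => ?_, fun p => ?_⟩
  · have hp := hbit p
    have hq := hbit q
    dsimp only at hpq
    by_cases c1 : p.1.1 0 = p.1.2 0 ∧ (t p).1 ≠ (Fin.tail α, fun i => !(Fin.tail α i)) <;>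
    by_cases c2 : q.1.1 0 = q.1.2 0 ∧ (t q).1 ≠ (Fin.tail α, fun i => !(Fin.tail α i))
    · rw [dif_pos c1, dif_pos c2, Sum.inl.injEq] at hpq
      rw [← c1.1, Bool.and_self] at hp
      rw [← c2.1, Bool.and_self] at hq
      exact hext p q (hp.trans hq.symm) (by rw [← c1.1, ← c2.1, hp, hq])
        (Subtype.mk.inj (hψ hpq))
    · rw [dif_pos c1, dif_neg c2] at hpq
      cases hpq
    · rw [dif_neg c1, dif_pos c2] at hpq
      cases hpq
    · rw [dif_neg c1, dif_neg c2, Sum.inr.injEq, Prod.mk.injEq] at hpq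
      obtain ⟨h1, h2⟩ := bits_eq_of_key_eq hp hq (hpq.1 ▸ hne p) (hne q) (hpq.1 ▸ c1) c2 hpq.2
      exact hext p q h1 h2 hpq.1
  · have hp := hbit p
    dsimp only
    split_ifs with c1 c2 <;> simp only [extendRect, Finset.mem_filter_univ, ← ht]
    · exact ⟨by grind, by grind, hmem ⟨t p, c1.2⟩⟩
    · exact ⟨by grind, by grind, trivial⟩
    · exact ⟨by grind, by grind, trivial⟩

/-- If `d ≥ 2` and `C(d-1)` has a `k`-uniform-covering, then `C(d)` has a
`(k + 2·3^{d-1})`-uniform-covering. -/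
theorem cset_uniformCovering_step (d : ℕ) (hd : 2 ≤ d) (k : ℕ)
    (hcov : HasUniformCovering (Cset (d - 1)) k) :
    HasUniformCovering (Cset d) (k + 2 * 3 ^ (d - 1)) := by
  obtain ⟨n, rfl⟩ : ∃ n, d = n + 1 := ⟨d - 1, by omega⟩
  exact hasUniformCovering_succ hcov
end

section
/- Let n ≥ 1 and let M be a nonnegative 2^n × 2^n matrix, with rows and columns indexed by {0,1}^n, of rank at most one and satisfying M_{a,b} = 0 whenever aᵀb = 1. Then val(M) ≤ 2^n, i.e., the number of pairs (a,b) ∈ {0,1}^n × {0,1}^n with aᵀb = 0 and M_{a,b} > 0 is at most 2^n. -/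
/-- `val M`: the number of pairs `(a,b) ∈ {0,1}ⁿ × {0,1}ⁿ` with `aᵀb = 0` and `M a b > 0`. -/
noncomputable def valM {n : ℕ} (M : Matrix (BitStr n) (BitStr n) ℝ) : ℕ :=
  (Finset.univ.filter fun p : BitStr n × BitStr n =>
    bitIP p.1 p.2 = 0 ∧ 0 < M p.1 p.2).card

theorem bitIP_cons {n : ℕ} (x y : Bool) (a b : BitStr n) :
    bitIP (Fin.cons x a : BitStr (n + 1)) (Fin.cons y b) =
      (if x && y then 1 else 0) + bitIP a b := by
  simp only [bitIP, Fin.sum_univ_succ, Fin.cons_zero, Fin.cons_succ]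

theorem sum_bitStr_succ {n : ℕ} (f : BitStr (n + 1) → ℕ) :
    ∑ a, f a = ∑ a : BitStr n, (f (Fin.cons true a) + f (Fin.cons false a)) := by
  rw [← (Fin.consEquiv fun _ : Fin (n + 1) => Bool).sum_comp, Fintype.sum_prod_type_right]
  simp [Fin.consEquiv]

open Classical in
/-- A rectangle of bit strings with no pair of inner product one contains at most `2 ^ n`
pairs of inner product zero. -/
theorem sum_bitIP_eq_zero_le_two_pow {n : ℕ} (A B : BitStr n → Prop)
    (h : ∀ a b, A a → B b → bitIP a b ≠ 1) :
    (∑ a, ∑ b, if bitIP a b = 0 ∧ A a ∧ B b then 1 else 0) ≤ 2 ^ n := by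
  induction n with
  | zero =>
    simp only [Finset.univ_unique, Finset.sum_singleton]
    split_ifs <;> simp
  | succ n ih =>
    have h₁ := ih (fun a => A (Fin.cons true a) ∨ A (Fin.cons false a))
      (fun b => B (Fin.cons false b)) (by
        rintro a b (ha | ha) hb <;> simpa [bitIP_cons] using h _ _ ha hb)
    have h₂ := ih (fun a => A (Fin.cons false a))
      (fun b => B (Fin.cons true b) ∨ B (Fin.cons false b)) (by
        rintro a b ha (hb | hb) <;> simpa [bitIP_cons] using h _ _ ha hb)
    rw [pow_succ, mul_two]
    refine le_trans ?_ (add_le_add h₁ h₂)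
    simp only [sum_bitStr_succ, ← Finset.sum_add_distrib]
    refine Finset.sum_le_sum fun a _ => Finset.sum_le_sum fun b _ => ?_
    have h₃ := h (Fin.cons true a) (Fin.cons true b)
    simp only [bitIP_cons, Bool.and_true, Bool.and_false, Bool.false_eq_true, if_true, if_false,
      zero_add] at h₃ ⊢
    grind

theorem Matrix.mul_eq_mul_of_rank_le_one {m n K : Type*} [Fintype m] [Fintype n] [Field K]
    (M : Matrix m n K) (h : M.rank ≤ 1) (i i' : m) (j j' : n) :
    M i j * M i' j' = M i j' * M i' j := by
  rw [Matrix.rank_eq_finrank_span_cols, finrank_le_one_iff] at h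
  obtain ⟨v, hv⟩ := h
  obtain ⟨c, hc⟩ := hv ⟨M.col j, Submodule.subset_span ⟨j, rfl⟩⟩
  obtain ⟨d, hd⟩ := hv ⟨M.col j', Submodule.subset_span ⟨j', rfl⟩⟩
  have hc' (k : m) : c * v.1 k = M k j := congrFun (congrArg Subtype.val hc) k
  have hd' (k : m) : d * v.1 k = M k j' := congrFun (congrArg Subtype.val hd) k
  rw [← hc', ← hc', ← hd', ← hd']
  ring

/-- Let `n ≥ 1` and let `M` be a nonnegative `2^n × 2^n` matrix of rank at most one
with `M a b = 0` whenever `aᵀb = 1`. Then `val(M) ≤ 2^n`. -/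
theorem valM_le_of_rank_le_one (n : ℕ) (hn : 1 ≤ n)
    (M : Matrix (BitStr n) (BitStr n) ℝ)
    (hnonneg : ∀ a b, 0 ≤ M a b)
    (hrank : M.rank ≤ 1)
    (hzero : ∀ a b, bitIP a b = 1 → M a b = 0) :
    valM M ≤ 2 ^ n := by
  classical
  have hrect : ∀ a b, (∃ b', 0 < M a b') → (∃ a', 0 < M a' b) → 0 < M a b := by
    rintro a b ⟨b', ha⟩ ⟨a', hb⟩
    refine (hnonneg a b).lt_of_ne' fun h0 => ?_
    have hmul := M.mul_eq_mul_of_rank_le_one hrank a a' b b'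
    rw [h0, zero_mul] at hmul
    exact (mul_pos ha hb).ne hmul
  have hsum := sum_bitIP_eq_zero_le_two_pow (fun a => ∃ b', 0 < M a b') (fun b => ∃ a', 0 < M a' b)
    fun a b ha hb hab => (hrect a b ha hb).ne' (hzero a b hab)
  refine le_trans ?_ hsum
  rw [valM, Finset.card_filter, Fintype.sum_prod_type]
  refine Finset.sum_le_sum fun a _ => Finset.sum_le_sum fun b _ => ?_
  by_cases hab : bitIP a b = 0 ∧ 0 < M a b
  · rw [if_pos hab, if_pos ⟨hab.1, ⟨b, hab.2⟩, ⟨a, hab.2⟩⟩]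
  · simp [hab]
end
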